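/- arXiv:math/0408007 — 5 statements merged into one kernel-verified Lean document; each statement's English description precedes it below -/
import Mathlib

section
/- Let ι be a linearly ordered type, let n ≥ 3, and let V be an additive commutative group. Suppose v : ι^n → V is a function of multi-indices K = (i₁,…,i_n) which is skew-symmetric in the first two positions (v(i₁,i₂,i₃,…,i_n) = −v(i₂,i₁,i₃,…,i_n)), is invariant under every permutation of the positions 3,…,n, and whose cyclic sum over the first three positions vanishes: v(i₁,i₂,i₃,i₄,…,i_n) + v(i₂,i₃,i₁,i₄,…,i_n) + v(i₃,i₁,i₂,i₄,…,i_n) = 0. Then there exists a unique function u : ι^n → V which is invariant under every permutation of the positions 2,…,n, satisfies v(i₁,i₂,i₃,…,i_n) = u(i₁,i₂,i₃,…,i_n) − u(i₂,i₁,i₃,…,i_n) for all multi-indices, and satisfies u(i₁,…,i_n) = 0 whenever i₁ ≤ i₂ ≤ ⋯ ≤ i_n. -/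
theorem aux_main {ι V : Type*} [LinearOrder ι] [AddCommGroup V]
    (n : ℕ) (v : (Fin n → ι) → V) (z o t : Fin n) (hzo : z ≠ o) (hzt : z ≠ t) (hot : o ≠ t)
    (hz : ∀ i, z ≤ i)
    (hskew : ∀ K : Fin n → ι, v K = - v (K ∘ Equiv.swap z o))
    (hsymm : ∀ σ : Equiv.Perm (Fin n), σ z = z → σ o = o → ∀ K : Fin n → ι, v (K ∘ σ) = v K)
    (hcyc : ∀ K : Fin n → ι,
      v K
      + v (K ∘ ((Equiv.swap o t).trans (Equiv.swap z o)))
      + v (K ∘ (((Equiv.swap o t).trans (Equiv.swap z o)).trans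
            ((Equiv.swap o t).trans (Equiv.swap z o)))) = 0) :
    ∃! u : (Fin n → ι) → V,
      (∀ σ : Equiv.Perm (Fin n), σ z = z → ∀ K : Fin n → ι, u (K ∘ σ) = u K) ∧
      (∀ K : Fin n → ι, v K = u K - u (K ∘ Equiv.swap z o)) ∧
      (∀ K : Fin n → ι, Monotone K → u K = 0) := by
  classical
  -- workhorse: only the images of `z` and `o` matter
  have hA : ∀ (K : Fin n → ι) (σ τ : Equiv.Perm (Fin n)), σ z = τ z → σ o = τ o →
      v (K ∘ σ) = v (K ∘ τ) := by
    intro K σ τ h0 h1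
    have := hsymm (τ⁻¹ * σ) (by simp [h0]) (by simp [h1]) (K ∘ τ)
    rw [← this]
    congr 1
    funext i
    simp
  have hskew' : ∀ (K : Fin n → ι) (σ τ : Equiv.Perm (Fin n)), σ z = τ o → σ o = τ z →
      v (K ∘ σ) = - v (K ∘ τ) := by
    intro K σ τ h0 h1
    rw [hskew (K ∘ σ)]
    have := hA K (σ * Equiv.swap z o) τ (by simp [h1]) (by simp [h0])
    rw [← this]
    rfl
  -- the relation at the position `j`
  have hC : ∀ (K : Fin n → ι) (j : Fin n), j ≠ z → j ≠ o →
      v K = v (K ∘ Equiv.swap o j) - v (K ∘ (Equiv.swap z o * Equiv.swap o j : Equiv.Perm _)) := by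
    intro K j hjz hjo
    have h := hcyc (K ∘ Equiv.swap t j)
    have e1 : v (K ∘ Equiv.swap t j) = v K :=
      hsymm _ (Equiv.swap_apply_of_ne_of_ne hzt hjz.symm)
        (Equiv.swap_apply_of_ne_of_ne hot hjo.symm) K
    have e2 := hA K (Equiv.swap t j * ((Equiv.swap o t).trans (Equiv.swap z o)))
      (Equiv.swap z o * Equiv.swap o j : Equiv.Perm _)
      (by
        have h1 := Equiv.swap_apply_of_ne_of_ne hzo hzt
        have h2 := Equiv.swap_apply_of_ne_of_ne hzo hjz.symm
        have h3 := Equiv.swap_apply_of_ne_of_ne hot hjo.symm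
        simp [h1, h2, h3])
      (by
        have h1 := Equiv.swap_apply_of_ne_of_ne hzt.symm hot.symm
        have h2 := Equiv.swap_apply_of_ne_of_ne hjz hjo
        simp [h1, h2])
    have e3 := hskew' K (Equiv.swap t j * (((Equiv.swap o t).trans (Equiv.swap z o)).trans
            ((Equiv.swap o t).trans (Equiv.swap z o)))) (Equiv.swap o j)
      (by
        have h1 := Equiv.swap_apply_of_ne_of_ne hzo hzt
        have h2 := Equiv.swap_apply_of_ne_of_ne hzt.symm hot.symm
        simp [h1, h2])
      (by
        have h1 := Equiv.swap_apply_of_ne_of_ne hzo hzt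
        have h2 := Equiv.swap_apply_of_ne_of_ne hzt.symm hot.symm
        have h3 := Equiv.swap_apply_of_ne_of_ne hzo hjz.symm
        have h4 := Equiv.swap_apply_of_ne_of_ne hzt hjz.symm
        simp [h1, h2, h3, h4])
    have e2' : v ((K ∘ Equiv.swap t j) ∘ ((Equiv.swap o t).trans (Equiv.swap z o)))
      = v (K ∘ (Equiv.swap z o * Equiv.swap o j : Equiv.Perm _)) := e2
    have e3' : v ((K ∘ Equiv.swap t j) ∘ (((Equiv.swap o t).trans (Equiv.swap z o)).trans
            ((Equiv.swap o t).trans (Equiv.swap z o)))) = - v (K ∘ Equiv.swap o j) := e3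
    rw [e1, e2', e3'] at h
    rw [← sub_eq_zero, ← h]
    abel
  have hswap : ∀ (K : Fin n → ι) (a b : Fin n), K a = K b → K ∘ Equiv.swap a b = K := by
    intro K a b h
    funext i
    simp only [Function.comp, Equiv.swap_apply_def]
    split_ifs with h1 h2
    · rw [h1, h]
    · rw [h2, h]
    · rfl
  -- vanishing on equal first two arguments
  have hD : ∀ (K : Fin n → ι), K z = K o → v K = 0 := by
    intro K h
    have h1 := hC K t hzt.symm hot.symm
    have h2 : K ∘ (Equiv.swap z o * Equiv.swap o t : Equiv.Perm _) = K ∘ Equiv.swap o t := by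
      change (K ∘ Equiv.swap z o) ∘ Equiv.swap o t = _
      rw [hswap K z o h]
    rw [h1, h2, sub_self]
  let w : (Fin n → ι) → Fin n → V := fun K j => if j = z then 0 else v (K ∘ Equiv.swap o j)
  have hw0 : ∀ K, w K z = 0 := fun K => by simp [w]
  have hw1 : ∀ K j, j ≠ z → w K j = v (K ∘ Equiv.swap o j) := fun K j h => by simp [w, h]
  have hwz : ∀ (K : Fin n → ι) (b : Fin n), K z = K b → w K b = 0 := by
    intro K b h
    by_cases hb : b = z
    · rw [hb, hw0]
    · rw [hw1 K b hb]
      apply hD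
      simp [Equiv.swap_apply_of_ne_of_ne hzo (Ne.symm hb), h]
  have hwe : ∀ (K : Fin n → ι) (a b : Fin n), K a = K b → w K a = w K b := by
    intro K a b h
    by_cases ha : a = z
    · subst ha; rw [hw0, hwz K b h]
    by_cases hb : b = z
    · subst hb; rw [hw0, hwz K a h.symm]
    rw [hw1 K a ha, hw1 K b hb]
    have := hA K (Equiv.swap a b * Equiv.swap o b) (Equiv.swap o a)
      (by simp [Equiv.swap_apply_of_ne_of_ne hzo (Ne.symm ha),
          Equiv.swap_apply_of_ne_of_ne hzo (Ne.symm hb),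
          Equiv.swap_apply_of_ne_of_ne (Ne.symm ha) (Ne.symm hb)])
      (by simp)
    rw [← this]
    change v ((K ∘ Equiv.swap a b) ∘ Equiv.swap o b) = _
    rw [hswap K a b h]
  have hws : ∀ (K : Fin n → ι) (σ : Equiv.Perm (Fin n)) (j : Fin n), σ z = z →
      w (K ∘ σ) j = w K (σ j) := by
    intro K σ j hσ
    by_cases hj : j = z
    · rw [hj, hσ, hw0, hw0]
    have hj' : σ j ≠ z := fun h => hj (σ.injective (h.trans hσ.symm))
    rw [hw1 _ j hj, hw1 _ _ hj']
    exact hA K (σ * Equiv.swap o j) (Equiv.swap o (σ j))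
      (by simp [Equiv.swap_apply_of_ne_of_ne hzo (Ne.symm hj),
          Equiv.swap_apply_of_ne_of_ne hzo (Ne.symm hj'), hσ])
      (by simp)
  haveI : Nonempty (Fin n) := ⟨z⟩
  have hmin : ∀ K : Fin n → ι, ∃ m, ∀ i, K m ≤ K i := fun K => Finite.exists_min K
  choose m hm using hmin
  have hu : ∀ (K : Fin n → ι) (j : Fin n), (∀ i, K j ≤ K i) → w K (m K) = w K j :=
    fun K j hj => hwe K _ _ (le_antisymm (hm K j) (hj _))
  refine ⟨fun K => w K (m K), ⟨?_, ?_, ?_⟩, ?_⟩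
  · intro σ hσ K
    change w (K ∘ σ) (m (K ∘ σ)) = w K (m K)
    rw [hws K σ _ hσ]
    refine (hu K _ fun i => ?_).symm
    have := hm (K ∘ σ) (σ.symm i)
    simpa using this
  · intro K
    change v K = w K (m K) - w (K ∘ Equiv.swap z o) (m (K ∘ Equiv.swap z o))
    have hmm : w (K ∘ Equiv.swap z o) (m (K ∘ Equiv.swap z o))
        = w (K ∘ Equiv.swap z o) (Equiv.swap z o (m K)) := by
      apply hu
      intro i
      simpa using hm K (Equiv.swap z o i)
    rw [hmm]
    by_cases h0 : m K = z
    · rw [h0, Equiv.swap_apply_left, hw0, hw1 _ _ hzo.symm, hskew K]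
      simp
    by_cases h1 : m K = o
    · rw [h1, Equiv.swap_apply_right, hw0, hw1 _ _ hzo.symm]
      simp
    rw [Equiv.swap_apply_of_ne_of_ne h0 h1, hw1 _ _ h0, hw1 _ _ h0]
    exact hC K _ h0 h1
  · intro K hK
    change w K (m K) = 0
    rw [hu K z (fun i => hK (hz i)), hw0]
  · rintro u ⟨h1, h2, h3⟩
    have hu0 : ∀ K : Fin n → ι, (∀ i, K z ≤ K i) → u K = 0 := by
      intro K hK
      have hs := Tuple.monotone_sort K
      have hp : K z = K (Tuple.sort K z) := by
        apply le_antisymm (hK _)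
        simpa using hs (hz ((Tuple.sort K).symm z))
      have := h1 (Equiv.swap z (Tuple.sort K z) * Tuple.sort K) (by simp) K
      rw [← this]
      change u ((K ∘ Equiv.swap z (Tuple.sort K z)) ∘ Tuple.sort K) = 0
      rw [hswap K _ _ hp]
      exact h3 _ hs
    funext K
    change u K = w K (m K)
    by_cases h0 : m K = z
    · rw [h0, hw0]
      apply hu0
      rw [← h0]
      exact hm K
    · have hz' := Equiv.swap_apply_of_ne_of_ne hzo (Ne.symm h0)
      rw [hw1 _ _ h0, h2, h1 _ hz']
      rw [hu0 ((K ∘ Equiv.swap o (m K)) ∘ Equiv.swap z o), sub_zero]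
      intro i
      simpa using hm K _

/-- Let `ι` be a linearly ordered type, `n ≥ 3`, and `V` an additive
commutative group.  If `v : ιⁿ → V` is skew-symmetric in the first two positions,
invariant under every permutation of positions `3,…,n`, and its cyclic sum over the
first three positions vanishes, then there is a unique `u : ιⁿ → V`, invariant under
every permutation of the positions `2,…,n`, with `v K = u K - u (K ∘ swap₀₁)` and
`u K = 0` whenever `K` is monotone (i.e. `i₁ ≤ i₂ ≤ ⋯ ≤ i_n`). -/
theorem stmt_0 {ι V : Type*} [LinearOrder ι] [AddCommGroup V]
    (n : ℕ) (hn : 3 ≤ n) (v : (Fin n → ι) → V)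
    -- skew-symmetry in the first two positions:
    (hskew : ∀ K : Fin n → ι,
      v K = - v (K ∘ Equiv.swap (⟨0, by omega⟩ : Fin n) ⟨1, by omega⟩))
    -- invariance under every permutation of the positions 3,…,n:
    (hsymm : ∀ σ : Equiv.Perm (Fin n),
      σ ⟨0, by omega⟩ = (⟨0, by omega⟩ : Fin n) →
      σ ⟨1, by omega⟩ = (⟨1, by omega⟩ : Fin n) →
      ∀ K : Fin n → ι, v (K ∘ σ) = v K)
    -- vanishing of the cyclic sum over the first three positions
    -- (here `c` is the cycle sending position 0 ↦ 1 ↦ 2 ↦ 0 used to rotate arguments):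
    (hcyc : ∀ K : Fin n → ι,
      v K
      + v (K ∘ ((Equiv.swap (⟨1, by omega⟩ : Fin n) ⟨2, by omega⟩).trans
            (Equiv.swap ⟨0, by omega⟩ ⟨1, by omega⟩)))
      + v (K ∘ (((Equiv.swap (⟨1, by omega⟩ : Fin n) ⟨2, by omega⟩).trans
            (Equiv.swap ⟨0, by omega⟩ ⟨1, by omega⟩)).trans
            ((Equiv.swap (⟨1, by omega⟩ : Fin n) ⟨2, by omega⟩).trans
            (Equiv.swap ⟨0, by omega⟩ ⟨1, by omega⟩)))) = 0) :
    ∃! u : (Fin n → ι) → V,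
      (∀ σ : Equiv.Perm (Fin n), σ ⟨0, by omega⟩ = (⟨0, by omega⟩ : Fin n) →
        ∀ K : Fin n → ι, u (K ∘ σ) = u K) ∧
      (∀ K : Fin n → ι,
        v K = u K - u (K ∘ Equiv.swap (⟨0, by omega⟩ : Fin n) ⟨1, by omega⟩)) ∧
      (∀ K : Fin n → ι, Monotone K → u K = 0) := by
  exact aux_main n v ⟨0, by omega⟩ ⟨1, by omega⟩ ⟨2, by omega⟩ (by simp) (by simp) (by simp)
    (fun i => Nat.zero_le _) hskew hsymm hcyc
end

section
/- Let F be a field of characteristic zero, let ι and κ be index types, and let n ≥ 2 be a natural number. Let p be a multivariate polynomial over F in the variables {X_i : i ∈ ι} ∪ {Y_j : j ∈ κ} (an element of MvPolynomial (ι ⊕ κ) F). Suppose that for all i, k ∈ ι the second partial derivative ∂²p/∂X_i∂X_k has total degree at most n − 2, and that for all j, l ∈ κ the second partial derivative ∂²p/∂Y_j∂Y_l has total degree at most n − 2. Then p has total degree at most n. -/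
open MvPolynomial

theorem exists_split {σ : Type*} (m : σ →₀ ℕ) (h : 1 ≤ m.degree) :
    ∃ (a : σ) (s : σ →₀ ℕ), m = s + Finsupp.single a 1 ∧ m.degree = s.degree + 1 := by
  classical
  have hm : m ≠ 0 := by
    rintro rfl
    simp at h
  obtain ⟨a, ha⟩ := Finsupp.ne_iff.mp hm
  have e : m = (m - Finsupp.single a 1) + Finsupp.single a 1 := by
    refine (tsub_add_cancel_of_le ?_).symm
    rw [Finsupp.single_le_iff]
    exact Nat.one_le_iff_ne_zero.mpr ha
  refine ⟨a, m - Finsupp.single a 1, e, ?_⟩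
  conv_lhs => rw [e]
  rw [map_add, Finsupp.degree_single]

theorem degree_le_of_pderiv {F : Type*} [Field F] [CharZero F] {σ : Type*}
    (p : MvPolynomial σ F) (a b : σ) (s m : σ →₀ ℕ) (n : ℕ) (hn : 2 ≤ n)
    (hm : m = s + Finsupp.single a 1 + Finsupp.single b 1)
    (hc : coeff m p ≠ 0) (hd : (pderiv a (pderiv b p)).totalDegree ≤ n - 2) :
    m.degree ≤ n := by
  have h : coeff s (pderiv a (pderiv b p)) ≠ 0 := by
    rw [coeff_pderiv, coeff_pderiv, ← hm]
    exact mul_ne_zero (mul_ne_zero hc (Nat.cast_add_one_ne_zero _))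
      (Nat.cast_add_one_ne_zero _)
  have h2 : s.degree ≤ n - 2 := (le_totalDegree (mem_support_iff.mpr h)).trans hd
  rw [hm, map_add, map_add, Finsupp.degree_single, Finsupp.degree_single]
  omega

/-- Over a field of characteristic zero, if all second partial
derivatives of a multivariate polynomial `p` in two groups of variables
`X_i (i ∈ ι)` and `Y_j (j ∈ κ)` taken twice in the `X`-group, and all second
partial derivatives taken twice in the `Y`-group, have total degree at most
`n - 2` (where `n ≥ 2`), then `p` has total degree at most `n`. -/
theorem stmt_1 {F : Type*} [Field F] [CharZero F] {ι κ : Type*}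
    (n : ℕ) (hn : 2 ≤ n) (p : MvPolynomial (ι ⊕ κ) F)
    (hX : ∀ i k : ι,
      (pderiv (Sum.inl i) (pderiv (Sum.inl k) p)).totalDegree ≤ n - 2)
    (hY : ∀ j l : κ,
      (pderiv (Sum.inr j) (pderiv (Sum.inr l) p)).totalDegree ≤ n - 2) :
    p.totalDegree ≤ n := by
  refine Finset.sup_le ?_
  intro m hm
  have hc := mem_support_iff.mp hm
  change m.degree ≤ n
  by_contra hlt
  obtain ⟨a, s, h1, d1⟩ := exists_split m (by omega)
  obtain ⟨b, t, h2, d2⟩ := exists_split s (by omega)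
  obtain ⟨c, u, h3, d3⟩ := exists_split t (by omega)
  apply hlt
  have e1 : m = (u + Finsupp.single c 1) + Finsupp.single b 1 + Finsupp.single a 1 := by
    rw [h1, h2, h3]
  have e2 : m = (u + Finsupp.single b 1) + Finsupp.single c 1 + Finsupp.single a 1 := by
    rw [e1]; abel
  have e3 : m = (u + Finsupp.single a 1) + Finsupp.single c 1 + Finsupp.single b 1 := by
    rw [e1]; abel
  have HX : ∀ (i k : ι) (v : ι ⊕ κ →₀ ℕ),
      m = v + Finsupp.single (Sum.inl i) 1 + Finsupp.single (Sum.inl k) 1 → m.degree ≤ n :=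
    fun i k v e => degree_le_of_pderiv p _ _ v m n hn e hc (hX i k)
  have HY : ∀ (i k : κ) (v : ι ⊕ κ →₀ ℕ),
      m = v + Finsupp.single (Sum.inr i) 1 + Finsupp.single (Sum.inr k) 1 → m.degree ≤ n :=
    fun i k v e => degree_le_of_pderiv p _ _ v m n hn e hc (hY i k)
  clear hX hY h1 h2 h3 d1 d2 d3
  rcases a with a | a
  · rcases b with b | b
    · exact HX b a _ e1
    · rcases c with c | c
      · exact HX c a _ e2
      · exact HY c b _ e3
  · rcases b with b | b
    · rcases c with c | c
      · exact HX c b _ e3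
      · exact HY c a _ e2
    · exact HY b a _ e1
end

section
/- Let F be a field of characteristic zero, let ι and κ be index types, and let p ∈ MvPolynomial (ι ⊕ κ) F be homogeneous of degree q in the variables {X_i : i ∈ ι} ∪ {Y_j : j ∈ κ}. Suppose ∂²p/∂X_i∂X_k = 0 for all i, k ∈ ι and ∂²p/∂Y_j∂Y_l = 0 for all j, l ∈ κ. Then: if q ≥ 3, p = 0; and if q = 2, p is a finite F-linear combination of the mixed products X_i·Y_j with i ∈ ι and j ∈ κ. -/
open MvPolynomial

lemma peel_aux {σ : Type*} (d : σ →₀ ℕ) (n : ℕ) (h : d.degree = n + 1) :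
    ∃ (a : σ) (m : σ →₀ ℕ), d = m + Finsupp.single a 1 ∧ m.degree = n := by
  have hd : d ≠ 0 := by
    rintro rfl
    simp at h
  obtain ⟨a, ha⟩ := Finsupp.ne_iff.mp hd
  have hle : Finsupp.single a 1 ≤ d := by
    rw [Finsupp.single_le_iff]
    exact Nat.one_le_iff_ne_zero.mpr ha
  have e : d = (d - Finsupp.single a 1) + Finsupp.single a 1 := (tsub_add_cancel_of_le hle).symm
  refine ⟨a, d - Finsupp.single a 1, e, ?_⟩
  rw [e, map_add, Finsupp.degree_single] at h
  omega

lemma coeff_aux {F σ : Type*} [Field F] [CharZero F] (p : MvPolynomial σ F) (a b : σ)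
    (h : pderiv a (pderiv b p) = 0) (m : σ →₀ ℕ) :
    coeff (m + Finsupp.single a 1 + Finsupp.single b 1) p = 0 := by
  have h1 := congrArg (coeff m) h
  rw [coeff_pderiv, coeff_pderiv, coeff_zero] at h1
  have hz (k : ℕ) : (k : F) + 1 ≠ 0 := Nat.cast_add_one_ne_zero k
  exact ((mul_eq_zero.mp ((mul_eq_zero.mp h1).resolve_right (hz _))).resolve_right (hz _))

/-- Over a field of characteristic zero, let `p` be a polynomial in two
groups of variables `X_i (i ∈ ι)`, `Y_j (j ∈ κ)` which is homogeneous of degree `q`, and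
suppose all second partials within the `X`-group and within the `Y`-group vanish.
Then `p = 0` if `q ≥ 3`, and `p` is a finite `F`-linear combination of the mixed
products `X_i · Y_j` if `q = 2`. -/
theorem stmt_2 {F : Type*} [Field F] [CharZero F] {ι κ : Type*}
    (q : ℕ) (p : MvPolynomial (ι ⊕ κ) F) (hp : p.IsHomogeneous q)
    (hX : ∀ i k : ι, pderiv (Sum.inl i) (pderiv (Sum.inl k) p) = 0)
    (hY : ∀ j l : κ, pderiv (Sum.inr j) (pderiv (Sum.inr l) p) = 0) :
    (3 ≤ q → p = 0) ∧
    (q = 2 → p ∈ Submodule.span F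
      (Set.range fun ij : ι × κ =>
        (X (Sum.inl ij.1) * X (Sum.inr ij.2) : MvPolynomial (ι ⊕ κ) F))) := by
  have deg : ∀ d, coeff d p ≠ 0 → d.degree = q := by
    intro d hd
    have := hp hd
    rw [Finsupp.degree_eq_weight_one (R := ℕ)]
    exact this
  constructor
  · intro hq
    ext d
    rw [coeff_zero]
    by_contra hd
    obtain ⟨c, m1, rfl, h1⟩ := peel_aux d (q - 1) (by have := deg d hd; omega)
    obtain ⟨b, m2, rfl, h2⟩ := peel_aux m1 (q - 2) (by omega)
    obtain ⟨a, m, rfl, h3⟩ := peel_aux m2 (q - 3) (by omega)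
    apply hd
    have key : ∀ (x y z : ι ⊕ κ), pderiv x (pderiv y p) = 0 →
        coeff (m + Finsupp.single z 1 + Finsupp.single x 1 + Finsupp.single y 1) p = 0 :=
      fun x y z h => coeff_aux p x y h _
    have e1 : m + Finsupp.single a 1 + Finsupp.single b 1 + Finsupp.single c 1
      = m + Finsupp.single b 1 + Finsupp.single a 1 + Finsupp.single c 1 := by abel
    have e2 : m + Finsupp.single a 1 + Finsupp.single b 1 + Finsupp.single c 1
      = m + Finsupp.single c 1 + Finsupp.single a 1 + Finsupp.single b 1 := by abel
    rcases a with a | a <;> rcases b with b | b <;> rcases c with c | c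
    · exact key _ _ _ (hX b c)
    · rw [e2]
      exact key _ _ _ (hX a b)
    · rw [e1]
      exact key _ _ _ (hX a c)
    · exact key _ _ _ (hY b c)
    · exact key _ _ _ (hX b c)
    · rw [e1]
      exact key _ _ _ (hY a c)
    · rw [e2]
      exact key _ _ _ (hY a b)
    · exact key _ _ _ (hY b c)
  · rintro rfl
    rw [p.as_sum]
    refine Submodule.sum_mem _ fun d hd => ?_
    rw [mem_support_iff] at hd
    obtain ⟨b, m1, rfl, h1⟩ := peel_aux d 1 (deg d hd)
    obtain ⟨a, m, rfl, h2⟩ := peel_aux m1 0 h1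
    have hm : m = 0 := (Finsupp.degree_eq_zero_iff m).mp h2
    subst hm
    have e : ∀ (x y : ι ⊕ κ) (r : F),
        monomial (0 + Finsupp.single x 1 + Finsupp.single y 1) r = r • (X x * X y) := by
      intro x y r
      simp [X, monomial_mul, smul_monomial]
    rw [e]
    apply Submodule.smul_mem
    apply Submodule.subset_span
    rcases a with a | a <;> rcases b with b | b
    · exact absurd (coeff_aux p _ _ (hX _ _) _) hd
    · exact ⟨(a, b), rfl⟩
    · exact ⟨(b, a), mul_comm _ _⟩
    · exact absurd (coeff_aux p _ _ (hY _ _) _) hd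
end

section
/- Let A be a Poisson algebra, n ≥ 1, and let {C_0,…,C_n} be a coherent family on A with C_k = 0 for all 0 ≤ k ≤ n−1. Then C_n is a symmetric multiderivation: C_n is invariant under every permutation of its n arguments, satisfies the Leibniz rule in each argument (in particular C_n(f·g, f_2,…,f_n) = f·C_n(g, f_2,…,f_n) + g·C_n(f, f_2,…,f_n)), and vanishes whenever one of its arguments is the multiplicative unit 1. -/
/-- A Poisson algebra structure (bracket) on a commutative ring `A`: a bracket which is
additive in each argument, antisymmetric, satisfies the Jacobi identity and the
Leibniz rule. -/
structure PoissonBracket (A : Type*) [CommRing A] where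
  bracket : A → A → A
  add_left : ∀ a b c, bracket (a + b) c = bracket a c + bracket b c
  add_right : ∀ a b c, bracket a (b + c) = bracket a b + bracket a c
  antisymm : ∀ a b, bracket a b = - bracket b a
  jacobi : ∀ a b c,
    bracket a (bracket b c) + bracket b (bracket c a) + bracket c (bracket a b) = 0
  leibniz : ∀ a b c, bracket a (b * c) = bracket a b * c + b * bracket a c

/-- Given a `(m+1)`-tuple `f` and `j : Fin m`, the `m`-tuple obtained by replacing the
adjacent pair `(f j, f (j+1))` by the single entry `br (f j) (f (j+1))`. -/
def mergeAt {A : Type*} (br : A → A → A) {m : ℕ} (j : Fin m) (f : Fin (m + 1) → A) :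
    Fin m → A :=
  fun i => if i < j then f i.castSucc
    else if i = j then br (f j.castSucc) (f j.succ) else f i.succ

/-- A coherent family `{C_0, …, C_n}` of operators on `A` (relative to a bracket `br`):
each `C_k` (`k ≤ n`) is additive in each argument, is a derivation in its first
argument (Property A), and swapping two adjacent arguments of `C_k` changes it by
`C_{k-1}` applied to the tuple with the pair replaced by its bracket (Property B). -/
structure IsCoherentFamily {A : Type*} [CommRing A] (br : A → A → A) (n : ℕ)
    (C : ∀ k : ℕ, (Fin k → A) → A) : Prop where
  additive : ∀ k, k ≤ n → ∀ (f : Fin k → A) (j : Fin k) (a b : A),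
    C k (Function.update f j (a + b)) =
      C k (Function.update f j a) + C k (Function.update f j b)
  leibniz_first : ∀ k, ∀ _ : k ≤ n, ∀ h0 : 0 < k, ∀ (f : Fin k → A) (a b : A),
    C k (Function.update f ⟨0, h0⟩ (a * b)) =
      a * C k (Function.update f ⟨0, h0⟩ b) + b * C k (Function.update f ⟨0, h0⟩ a)
  swap_adjacent : ∀ m, m + 1 ≤ n → ∀ (j : Fin m) (f : Fin (m + 1) → A),
    C (m + 1) f - C (m + 1) (f ∘ Equiv.swap j.castSucc j.succ) = C m (mergeAt br j f)


/-- If `{C_0,…,C_n}` (`n ≥ 1`) is a coherent family on a Poisson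
algebra `A` with `C_k = 0` for all `0 ≤ k ≤ n−1`, then `C_n` is a symmetric
multiderivation: invariant under every permutation of its arguments, Leibniz in each
argument, and vanishing whenever one argument is the unit `1`. -/
theorem stmt_7 {A : Type*} [CommRing A] (P : PoissonBracket A)
    (n : ℕ) (hn : 1 ≤ n) (C : ∀ k : ℕ, (Fin k → A) → A)
    (hC : IsCoherentFamily P.bracket n C)
    (hvan : ∀ k, k < n → ∀ f : Fin k → A, C k f = 0) :
    (∀ (σ : Equiv.Perm (Fin n)) (f : Fin n → A), C n (f ∘ σ) = C n f) ∧
    (∀ (f : Fin n → A) (j : Fin n) (a b : A),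
      C n (Function.update f j (a * b)) =
        a * C n (Function.update f j b) + b * C n (Function.update f j a)) ∧
    (∀ (f : Fin n → A) (j : Fin n), f j = 1 → C n f = 0) := by
  obtain ⟨m, rfl⟩ : ∃ m, n = m + 1 := ⟨n - 1, by omega⟩
  have hsym : ∀ (σ : Equiv.Perm (Fin (m + 1))) (f : Fin (m + 1) → A),
      C (m + 1) (f ∘ σ) = C (m + 1) f := by
    intro σ
    have hσ : σ ∈ Submonoid.closure
        (Set.range fun i : Fin m => Equiv.swap i.castSucc i.succ) := by
      rw [Equiv.Perm.mclosure_swap_castSucc_succ]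
      trivial
    induction hσ using Submonoid.closure_induction with
    | mem x hx =>
      obtain ⟨j, rfl⟩ := hx
      intro f
      have h := hC.swap_adjacent m le_rfl j f
      rw [hvan m (Nat.lt_succ_self m)] at h
      exact (sub_eq_zero.mp h).symm
    | one => intro f; rfl
    | mul x y _ _ hx hy =>
      intro f
      rw [Equiv.Perm.coe_mul, ← Function.comp_assoc, hy, hx]
  have hupd : ∀ (f : Fin (m + 1) → A) (j : Fin (m + 1)) (a : A),
      C (m + 1) (Function.update f j a) =
        C (m + 1) (Function.update (f ∘ Equiv.swap 0 j) ⟨0, Nat.succ_pos m⟩ a) := by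
    intro f j a
    rw [← hsym (Equiv.swap 0 j)]
    congr 1
    rw [Function.update_comp_equiv]
    simp
  have hleib : ∀ (f : Fin (m + 1) → A) (j : Fin (m + 1)) (a b : A),
      C (m + 1) (Function.update f j (a * b)) =
        a * C (m + 1) (Function.update f j b) + b * C (m + 1) (Function.update f j a) := by
    intro f j a b
    simp only [hupd f j]
    exact hC.leibniz_first (m + 1) le_rfl _ _ a b
  refine ⟨hsym, hleib, ?_⟩
  intro f j hj
  have h := hleib f j 1 1
  rw [mul_one, one_mul, ← hj, Function.update_eq_self] at h
  simpa using h
end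

section
/- Let A be a Poisson algebra and n ≥ 1. Suppose {C_0,…,C_{n−1},C_n} and {C_0,…,C_{n−1},C'_n} are two coherent families on A which agree in all degrees below n. Then the difference D := C_n − C'_n is a symmetric multiderivation: D is invariant under every permutation of its n arguments and satisfies the Leibniz rule D(f·g, f_2,…,f_n) = f·D(g, f_2,…,f_n) + g·D(f, f_2,…,f_n) in each argument. (This is the uniqueness part of the extension theorem for coherent families: the extending operator is unique up to a symmetric multiderivation.) -/
/-- If `{C_0,…,C_{n-1},C_n}` and `{C_0,…,C_{n-1},C'_n}` are two
coherent families on a Poisson algebra `A` agreeing in all degrees below `n` (`n ≥ 1`),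
then `D := C_n − C'_n` is a symmetric multiderivation: invariant under every
permutation of its `n` arguments and Leibniz in each argument. -/
theorem stmt_8 {A : Type*} [CommRing A] (P : PoissonBracket A)
    (n : ℕ) (hn : 1 ≤ n) (C C' : ∀ k : ℕ, (Fin k → A) → A)
    (hC : IsCoherentFamily P.bracket n C)
    (hC' : IsCoherentFamily P.bracket n C')
    (hagree : ∀ k, k < n → ∀ f : Fin k → A, C k f = C' k f) :
    (∀ (σ : Equiv.Perm (Fin n)) (f : Fin n → A),
      C n (f ∘ σ) - C' n (f ∘ σ) = C n f - C' n f) ∧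
    (∀ (f : Fin n → A) (j : Fin n) (a b : A),
      C n (Function.update f j (a * b)) - C' n (Function.update f j (a * b)) =
        a * (C n (Function.update f j b) - C' n (Function.update f j b))
          + b * (C n (Function.update f j a) - C' n (Function.update f j a))) := by
  obtain ⟨m, rfl⟩ : ∃ m, n = m + 1 := ⟨n - 1, by omega⟩
  have hadj : ∀ (j : Fin m) (f : Fin (m + 1) → A),
      C (m + 1) (f ∘ Equiv.swap j.castSucc j.succ)
        - C' (m + 1) (f ∘ Equiv.swap j.castSucc j.succ) = C (m + 1) f - C' (m + 1) f := by
    intro j f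
    have h1 := hC.swap_adjacent m le_rfl j f
    have h2 := hC'.swap_adjacent m le_rfl j f
    have h3 := hagree m (Nat.lt_succ_self m) (mergeAt P.bracket j f)
    linear_combination h2 - h1 - h3
  have hsymm : ∀ (σ : Equiv.Perm (Fin (m + 1))) (f : Fin (m + 1) → A),
      C (m + 1) (f ∘ σ) - C' (m + 1) (f ∘ σ) = C (m + 1) f - C' (m + 1) f := by
    intro σ
    have hσ : σ ∈ Submonoid.closure
        (Set.range fun i : Fin m => Equiv.swap i.castSucc i.succ) := by
      rw [Equiv.Perm.mclosure_swap_castSucc_succ]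
      trivial
    induction hσ using Submonoid.closure_induction with
    | mem x hx =>
      obtain ⟨i, rfl⟩ := hx
      exact hadj i
    | one => intro f; rfl
    | mul x y _ _ hx hy =>
      intro f
      have h := hy (f ∘ x)
      rw [hx f] at h
      exact h
  refine ⟨hsymm, ?_⟩
  intro f j a b
  have key : ∀ c : A, C (m + 1) (Function.update f j c) - C' (m + 1) (Function.update f j c)
      = C (m + 1) (Function.update (f ∘ Equiv.swap 0 j) ⟨0, Nat.succ_pos m⟩ c)
        - C' (m + 1) (Function.update (f ∘ Equiv.swap 0 j) ⟨0, Nat.succ_pos m⟩ c) := by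
    intro c
    rw [← hsymm (Equiv.swap 0 j) (Function.update f j c)]
    have h : Function.update f j c ∘ Equiv.swap 0 j
        = Function.update (f ∘ Equiv.swap 0 j) ⟨0, Nat.succ_pos m⟩ c := by
      rw [Function.update_comp_equiv]
      simp
    rw [h]
  rw [key, key, key, hC.leibniz_first (m + 1) le_rfl, hC'.leibniz_first (m + 1) le_rfl]
  ring
end
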